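/- There is an absolute constant C such that for all sufficiently large x and every prime p ≤ (log x)², the number of n ∈ Ω_x with p | s(n) is at most C·x·log₄ x / p, where Ω_x = {n ≤ x : n composite, P⁺(n) > x^{1/log₄ x}, P⁺(n)² ∤ n}. -/

import Mathlib

open Filter

/-- `maxPrimeFac n` is the largest prime factor `P⁺(n)` of `n`, with `P⁺(1) = 1`. -/
def maxPrimeFac (n : ℕ) : ℕ := if n = 1 then 1 else n.primeFactors.sup id

/-- The set `Ω_x` of composite `n ≤ x` with `P⁺(n) > x^{1/log₄ x}` and `P⁺(n)² ∤ n`. -/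
noncomputable def OmegaSet (x : ℝ) : Finset ℕ :=
  (Finset.Icc 2 ⌊x⌋₊).filter (fun n : ℕ =>
    ¬ n.Prime ∧
    (maxPrimeFac n : ℝ) > x ^ (1 / Real.log (Real.log (Real.log (Real.log x)))) ∧
    ¬ (maxPrimeFac n) ^ 2 ∣ n)

/-- `s(n) = σ(n) − n`, the sum of the proper divisors of `n`. -/
def sOf (n : ℕ) : ℕ := ∑ d ∈ n.properDivisors, d

namespace BoundingSieve

open Finset ArithmeticFunction

open scoped ArithmeticFunction.Moebius

variable {s : BoundingSieve}

theorem errSum_lambdaSquared_le (w : ℕ → ℝ) (hrem : ∀ d, d ∣ s.prodPrimes → |s.rem d| ≤ 1) :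
    s.errSum (lambdaSquared w) ≤ (∑ d ∈ s.prodPrimes.divisors, |w d|) ^ 2 := by
  set D := s.prodPrimes.divisors with hD
  calc s.errSum (lambdaSquared w)
      ≤ ∑ d ∈ D, ∑ d₁ ∈ D, ∑ d₂ ∈ D, if d = Nat.lcm d₁ d₂ then |w d₁| * |w d₂| else 0 := by
        refine sum_le_sum fun d hd ↦ ?_
        have hdP : d ∣ s.prodPrimes := Nat.dvd_of_mem_divisors hd
        have hsub : d.divisors ⊆ D := Nat.divisors_subset_of_dvd prodPrimes_ne_zero hdP
        have hpos : ∀ d₁ d₂, 0 ≤ if d = Nat.lcm d₁ d₂ then |w d₁| * |w d₂| else 0 := by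
          intro d₁ d₂; split_ifs <;> positivity
        calc |lambdaSquared w d| * |s.rem d| ≤ |lambdaSquared w d| :=
              mul_le_of_le_one_right (abs_nonneg _) (hrem d hdP)
          _ ≤ ∑ d₁ ∈ d.divisors, ∑ d₂ ∈ d.divisors,
                if d = Nat.lcm d₁ d₂ then |w d₁| * |w d₂| else 0 := by
              refine (abs_sum_le_sum_abs _ _).trans (sum_le_sum fun d₁ _ ↦ ?_)
              refine (abs_sum_le_sum_abs _ _).trans (sum_le_sum fun d₂ _ ↦ ?_)
              split_ifs <;> simp [abs_mul]
          _ ≤ ∑ d₁ ∈ D, ∑ d₂ ∈ D, if d = Nat.lcm d₁ d₂ then |w d₁| * |w d₂| else 0 := by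
              refine (sum_le_sum fun d₁ _ ↦ sum_le_sum_of_subset_of_nonneg hsub
                fun _ _ _ ↦ hpos _ _).trans ?_
              exact sum_le_sum_of_subset_of_nonneg hsub
                fun _ _ _ ↦ sum_nonneg fun _ _ ↦ hpos _ _
    _ = ∑ d₁ ∈ D, ∑ d₂ ∈ D, ∑ d ∈ D, if d = Nat.lcm d₁ d₂ then |w d₁| * |w d₂| else 0 := by
        rw [sum_comm, sum_congr rfl fun _ _ ↦ sum_comm]
    _ ≤ ∑ d₁ ∈ D, ∑ d₂ ∈ D, |w d₁| * |w d₂| := by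
        refine sum_le_sum fun d₁ _ ↦ sum_le_sum fun d₂ _ ↦ ?_
        rw [sum_ite_eq']
        split_ifs
        · exact le_rfl
        · positivity
    _ = (∑ d ∈ D, |w d|) ^ 2 := by rw [sq, sum_mul_sum]

/-- The normalising sum `∑_{l ∣ P, l ≤ R} g(l)` of Selberg's sieve. -/
noncomputable def selbergSum (s : BoundingSieve) (R : ℕ) : ℝ :=
  ∑ l ∈ s.prodPrimes.divisors, if l ≤ R then s.selbergTerms l else 0

/-- The optimal weights of Selberg's sieve, supported on `d ≤ R`. -/
noncomputable def selbergWeight (s : BoundingSieve) (R d : ℕ) : ℝ :=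
  (s.nu d)⁻¹ * (μ d : ℝ) *
    (∑ l ∈ s.prodPrimes.divisors, if d ∣ l ∧ l ≤ R then s.selbergTerms l else 0) / s.selbergSum R

theorem selbergSum_pos {R : ℕ} (hR : 1 ≤ R) : 0 < s.selbergSum R := by
  refine sum_pos' (fun l hl ↦ ?_) ⟨1, by simp [prodPrimes_ne_zero], ?_⟩
  · have := s.selbergTerms_pos (Nat.dvd_of_mem_divisors hl)
    split_ifs <;> positivity
  · rw [if_pos hR]; exact s.selbergTerms_pos (one_dvd _)

theorem selbergWeight_one {R : ℕ} (hR : 1 ≤ R) : s.selbergWeight R 1 = 1 := by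
  have := (s.selbergSum_pos hR).ne'
  simp only [selbergWeight, s.nu_mult.map_one, one_dvd, true_and]
  rw [← selbergSum]
  simp [this]

theorem sum_moebius_between {l m : ℕ} (hlm : l ∣ m) (hm : Squarefree m) (P : ℕ) (hmP : m ∣ P)
    (hP : P ≠ 0) :
    ∑ d ∈ P.divisors, (if l ∣ d ∧ d ∣ m then (μ d : ℝ) else 0) = if l = m then (μ l : ℝ) else 0 := by
  obtain ⟨k, rfl⟩ := hlm
  have hl0 : 0 < l := Nat.pos_of_ne_zero (left_ne_zero_of_mul hm.ne_zero)
  have hk0 : k ≠ 0 := right_ne_zero_of_mul hm.ne_zero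
  have hcop : l.Coprime k := Nat.coprime_of_squarefree_mul hm
  have key : ∑ d ∈ P.divisors, (if l ∣ d ∧ d ∣ l * k then (μ d : ℝ) else 0)
      = ∑ e ∈ k.divisors, (μ (l * e) : ℝ) := by
    rw [← sum_filter]
    symm
    refine sum_bij (fun e _ ↦ l * e) ?_ ?_ ?_ ?_
    · intro e he
      have := Nat.dvd_of_mem_divisors he
      simp only [mem_filter, Nat.mem_divisors]
      exact ⟨⟨(mul_dvd_mul_left l this).trans hmP, hP⟩, dvd_mul_right _ _, mul_dvd_mul_left l this⟩
    · intro a _ b _ h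
      exact Nat.eq_of_mul_eq_mul_left hl0 h
    · intro d hd
      simp only [mem_filter, Nat.mem_divisors] at hd
      obtain ⟨_, ⟨e, rfl⟩, h⟩ := hd
      exact ⟨e, Nat.mem_divisors.2 ⟨Nat.dvd_of_mul_dvd_mul_left hl0 h, hk0⟩, rfl⟩
    · intros; rfl
  rw [key]
  have : ∀ e ∈ k.divisors, (μ (l * e) : ℝ) = μ l * μ e := by
    intro e he
    rw [isMultiplicative_moebius.map_mul_of_coprime
      (hcop.coprime_dvd_right (Nat.dvd_of_mem_divisors he))]
    push_cast; rfl
  rw [sum_congr rfl this, ← mul_sum]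
  have h2 : ∑ e ∈ k.divisors, (μ e : ℝ) = if k = 1 then 1 else 0 := by
    have := congrArg (fun f : ArithmeticFunction ℤ ↦ f k) moebius_mul_coe_zeta
    simp only [coe_mul_zeta_apply, one_apply] at this
    exact_mod_cast this
  rw [h2]
  by_cases hk : k = 1
  · simp [hk]
  · have : l ≠ l * k := fun h ↦ hk (Nat.eq_of_mul_eq_mul_left hl0 (by simpa using h.symm))
    simp [hk, this]

theorem sum_nu_mul_selbergWeight {R l : ℕ} (hl : l ∣ s.prodPrimes) :
    (∑ d ∈ s.prodPrimes.divisors, if l ∣ d then s.nu d * s.selbergWeight R d else 0) =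
      (if l ≤ R then s.selbergTerms l else 0) * μ l / s.selbergSum R := by
  set D := s.prodPrimes.divisors with hD
  calc (∑ d ∈ D, if l ∣ d then s.nu d * s.selbergWeight R d else 0)
      = ∑ d ∈ D, ∑ m ∈ D, (if l ∣ d ∧ d ∣ m then (μ d : ℝ) else 0) *
          ((if m ≤ R then s.selbergTerms m else 0) / s.selbergSum R) := by
        refine sum_congr rfl fun d hd ↦ ?_
        have hnu := s.nu_ne_zero (Nat.dvd_of_mem_divisors hd)
        split_ifs with h
        · rw [selbergWeight, ← hD, mul_sum, sum_div, mul_sum]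
          refine sum_congr rfl fun m _ ↦ ?_
          by_cases h1 : d ∣ m <;> by_cases h2 : m ≤ R <;> simp [h, h1, h2]
          field_simp
        · simp [h]
    _ = ∑ m ∈ D, (if l = m then (μ l : ℝ) else 0) *
          ((if m ≤ R then s.selbergTerms m else 0) / s.selbergSum R) := by
        rw [sum_comm]
        refine sum_congr rfl fun m hm ↦ ?_
        have hmP := Nat.dvd_of_mem_divisors hm
        rw [← sum_mul]
        congr 1
        by_cases hlm : l ∣ m
        · exact sum_moebius_between hlm (s.squarefree_of_dvd_prodPrimes hmP) _ hmP
            prodPrimes_ne_zero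
        · rw [if_neg (fun h : l = m ↦ hlm h.dvd)]
          exact sum_eq_zero fun d _ ↦ if_neg fun h ↦ hlm (h.1.trans h.2)
    _ = _ := by
        simp only [ite_mul, zero_mul]
        rw [sum_ite_eq, if_pos (Nat.mem_divisors.2 ⟨hl, prodPrimes_ne_zero⟩)]
        split_ifs <;> ring

theorem mainSum_selbergWeight {R : ℕ} (hR : 1 ≤ R) :
    s.mainSum (lambdaSquared (s.selbergWeight R)) = (s.selbergSum R)⁻¹ := by
  have hS := (s.selbergSum_pos hR).ne'
  rw [mainSum_lambdaSquared_eq_sum_mul_sum_sq]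
  have : ∀ l ∈ s.prodPrimes.divisors, (s.selbergTerms l)⁻¹ *
      (∑ d ∈ s.prodPrimes.divisors, if l ∣ d then s.nu d * s.selbergWeight R d else 0) ^ 2 =
      (if l ≤ R then s.selbergTerms l else 0) * ((s.selbergSum R)⁻¹ ^ 2) := by
    intro l hl
    have hl' := Nat.dvd_of_mem_divisors hl
    have hg := (s.selbergTerms_pos hl').ne'
    have hmu : (μ l : ℝ) ^ 2 = 1 := by
      exact_mod_cast moebius_sq_eq_one_of_squarefree (s.squarefree_of_dvd_prodPrimes hl')
    rw [sum_nu_mul_selbergWeight hl', div_pow, mul_pow, hmu]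
    split_ifs
    · field_simp
    · simp
  rw [sum_congr rfl this, ← sum_mul, ← selbergSum]
  field_simp

theorem abs_selbergWeight_le {R d : ℕ} (hR : 1 ≤ R) (hd : d ∣ s.prodPrimes)
    (hnu : (s.nu d)⁻¹ ≤ d) :
    |s.selbergWeight R d| ≤ if d ≤ R then (R : ℝ) else 0 := by
  have hS := s.selbergSum_pos hR
  have hg : ∀ l ∈ s.prodPrimes.divisors, 0 < s.selbergTerms l :=
    fun l hl ↦ s.selbergTerms_pos (Nat.dvd_of_mem_divisors hl)
  set F := ∑ l ∈ s.prodPrimes.divisors, if d ∣ l ∧ l ≤ R then s.selbergTerms l else 0 with hF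
  have hF0 : 0 ≤ F := sum_nonneg fun l hl ↦ by
    have := hg l hl
    split_ifs <;> positivity
  split_ifs with hdR
  · have hFS : F ≤ s.selbergSum R := sum_le_sum fun l hl ↦ by
      have := hg l hl
      by_cases h1 : d ∣ l <;> by_cases h2 : l ≤ R <;> simp [h1, h2, this.le]
    have hmu : |(μ d : ℝ)| ≤ 1 := by exact_mod_cast abs_moebius_le_one (n := d)
    have hnu0 := s.nu_pos_of_dvd_prodPrimes hd
    have hdR' : (d : ℝ) ≤ R := by exact_mod_cast hdR
    calc |s.selbergWeight R d| = (s.nu d)⁻¹ * |(μ d : ℝ)| * (F / s.selbergSum R) := by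
          rw [selbergWeight, ← hF, abs_div, abs_mul, abs_mul, abs_of_pos (inv_pos.2 hnu0),
            abs_of_pos hS, abs_of_nonneg hF0, mul_div_assoc]
      _ ≤ R * 1 * 1 := by
          gcongr
          · exact hnu.trans hdR'
          · exact (div_le_one hS).2 hFS
      _ = R := by ring
  · have : F = 0 := sum_eq_zero fun l hl ↦ if_neg fun h ↦ hdR
      ((Nat.le_of_dvd (Nat.pos_of_mem_divisors hl) h.1).trans h.2)
    simp [selbergWeight, ← hF, this]

/-- A form of Selberg's upper bound sieve with a crude error term. -/
theorem siftedSum_le_div_selbergSum_add {R : ℕ} (hR : 1 ≤ R)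
    (hnu : ∀ d, d ∣ s.prodPrimes → (s.nu d)⁻¹ ≤ d) (hrem : ∀ d, d ∣ s.prodPrimes → |s.rem d| ≤ 1) :
    s.siftedSum ≤ s.totalMass / s.selbergSum R + (R : ℝ) ^ 4 := by
  refine (siftedSum_le_mainSum_errSum_of_upperMoebius _
    (upperMoebius_lambdaSquared (s.selbergWeight R) (selbergWeight_one hR))).trans ?_
  rw [mainSum_selbergWeight hR, ← div_eq_mul_inv]
  gcongr
  refine (errSum_lambdaSquared_le _ hrem).trans ?_
  have : ∑ d ∈ s.prodPrimes.divisors, |s.selbergWeight R d| ≤ (R : ℝ) ^ 2 := by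
    calc ∑ d ∈ s.prodPrimes.divisors, |s.selbergWeight R d|
        ≤ ∑ d ∈ s.prodPrimes.divisors, if d ≤ R then (R : ℝ) else 0 :=
          sum_le_sum fun d hd ↦ abs_selbergWeight_le hR (Nat.dvd_of_mem_divisors hd)
            (hnu d (Nat.dvd_of_mem_divisors hd))
      _ = (#{d ∈ s.prodPrimes.divisors | d ≤ R} : ℝ) * R := by
          rw [← sum_filter, sum_const, nsmul_eq_mul]
      _ ≤ R * R := by
          gcongr
          calc #{d ∈ s.prodPrimes.divisors | d ≤ R} ≤ #(Icc 1 R) := by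
                refine card_le_card fun d hd ↦ ?_
                rw [mem_filter] at hd
                exact mem_Icc.2 ⟨Nat.pos_of_mem_divisors hd.1, hd.2⟩
            _ = R := by simp
      _ = (R : ℝ) ^ 2 := by ring
  calc (∑ d ∈ s.prodPrimes.divisors, |s.selbergWeight R d|) ^ 2 ≤ ((R : ℝ) ^ 2) ^ 2 := by gcongr
    _ = (R : ℝ) ^ 4 := by ring

end BoundingSieve

section ResidueClass

open Finset ArithmeticFunction

/-- The product of the primes up to `R` other than `p`. -/
def primorialExcept (p R : ℕ) : ℕ := ∏ q ∈ Icc 1 R with q.Prime ∧ q ≠ p, q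

theorem squarefree_primorialExcept (p R : ℕ) : Squarefree (primorialExcept p R) := by
  refine Finset.squarefree_prod_of_pairwise_isCoprime (fun q hq r hr hqr ↦ ?_) fun q hq ↦ ?_
  · simp only [coe_filter, Set.mem_ofPred_eq] at hq hr
    exact Nat.coprime_iff_isRelPrime.1 ((Nat.coprime_primes hq.2.1 hr.2.1).2 hqr)
  · exact (mem_filter.1 hq).2.1.prime.squarefree

theorem coprime_primorialExcept {p : ℕ} (hp : p.Prime) (R : ℕ) :
    p.Coprime (primorialExcept p R) := by
  refine Nat.Coprime.prod_right fun q hq ↦ ?_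
  have := (mem_filter.1 hq).2
  exact (Nat.coprime_primes hp this.1).2 this.2.symm

theorem dvd_primorialExcept {p R l : ℕ} (hl : Squarefree l) (hlR : l ≤ R) (hpl : ¬ p ∣ l) :
    l ∣ primorialExcept p R := by
  rw [← Nat.prod_primeFactors_of_squarefree hl]
  refine prod_dvd_prod_of_subset _ _ _ fun q hq ↦ ?_
  have hq' := Nat.mem_primeFactors.1 hq
  have := Nat.le_of_dvd (Nat.pos_of_ne_zero hq'.2.2) hq'.2.1
  simp only [mem_filter, mem_Icc]
  exact ⟨⟨hq'.1.one_le, this.trans hlR⟩, hq'.1, fun h ↦ hpl (h ▸ hq'.2.1)⟩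

theorem coprime_primorialExcept_of_forall {p R n : ℕ} (h : ∀ q, q.Prime → q ≤ R → ¬ q ∣ n) :
    (primorialExcept p R).Coprime n := by
  refine Nat.Coprime.prod_left fun q hq ↦ ?_
  simp only [mem_filter, mem_Icc] at hq
  exact (Nat.Prime.coprime_iff_not_dvd hq.2.1).2 (h q hq.2.1 hq.1.2)

theorem sum_Icc_inv_sq_le_two (R : ℕ) : ∑ k ∈ Icc 1 R, ((k : ℝ) ^ 2)⁻¹ ≤ 2 := by
  rcases Nat.eq_zero_or_pos R with rfl | hR
  · simp
  · rw [Icc_eq_cons_Ioc hR, sum_cons]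
    have := sum_Ioc_inv_sq_le_sub (α := ℝ) one_ne_zero hR
    have h2 : (0 : ℝ) ≤ (R : ℝ)⁻¹ := by positivity
    norm_num at this ⊢
    linarith

/-- Every `n ≤ R` is of the form `l * (k ^ 2 * p ^ e)` with `l` squarefree and prime to `p`. -/
theorem Icc_subset_image_primorialExcept {p : ℕ} (hp : p.Prime) (R : ℕ) :
    Icc 1 R ⊆ ({l ∈ (primorialExcept p R).divisors | l ≤ R} ×ˢ (Icc 1 R ×ˢ range 2)).image
      fun t ↦ t.1 * (t.2.1 ^ 2 * p ^ t.2.2) := by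
  intro n hn
  rw [mem_Icc] at hn
  obtain ⟨a, b, ha, hb, hab, hsq⟩ := Nat.sq_mul_squarefree_of_pos hn.1
  have haR : a ≤ R := (Nat.le_of_dvd hn.1 (hab ▸ dvd_mul_left _ _)).trans hn.2
  have hbR : b ≤ R :=
    (Nat.le_of_dvd hn.1 (hab ▸ (dvd_pow_self b two_ne_zero).mul_right _)).trans hn.2
  have key : ∀ l e, Squarefree l → l ≤ R → ¬ p ∣ l → e < 2 → l * (b ^ 2 * p ^ e) = n →
      n ∈ ({l ∈ (primorialExcept p R).divisors | l ≤ R} ×ˢ (Icc 1 R ×ˢ range 2)).image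
        fun t ↦ t.1 * (t.2.1 ^ 2 * p ^ t.2.2) := by
    intro l e hl hlR hpl he hn
    refine mem_image.2 ⟨(l, b, e), ?_, hn⟩
    simp only [mem_product, mem_filter, Nat.mem_divisors, mem_Icc, mem_range]
    exact ⟨⟨⟨dvd_primorialExcept hl hlR hpl, (squarefree_primorialExcept p R).ne_zero⟩, hlR⟩,
      ⟨hb, hbR⟩, he⟩
  by_cases hpa : p ∣ a
  · obtain ⟨c, rfl⟩ := hpa
    refine key c 1 hsq.of_mul_right ((Nat.le_mul_of_pos_left c hp.pos).trans haR)
      (fun h ↦ hp.one_lt.ne' (Nat.isUnit_iff.1 (hsq p (mul_dvd_mul_left p h)))) one_lt_two ?_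
    rw [← hab, pow_one]
    ac_rfl
  · refine key a 0 hsq haR hpa two_pos ?_
    rw [← hab, pow_zero]
    ac_rfl

theorem log_succ_le_three_mul_sum_inv {p : ℕ} (hp : p.Prime) (R : ℕ) :
    Real.log (R + 1) ≤
      3 * ∑ l ∈ (primorialExcept p R).divisors, if l ≤ R then (l : ℝ)⁻¹ else 0 := by
  have hsub := Icc_subset_image_primorialExcept hp R
  rw [← sum_filter]
  generalize {l ∈ (primorialExcept p R).divisors | l ≤ R} = L at hsub ⊢
  have hp2 : (2 : ℝ) ≤ p := by exact_mod_cast hp.two_le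
  have hprod : ∑ t ∈ L ×ˢ (Icc 1 R ×ˢ range 2), (((t.1 * (t.2.1 ^ 2 * p ^ t.2.2) : ℕ)) : ℝ)⁻¹ =
      (∑ l ∈ L, (l : ℝ)⁻¹) * ((∑ k ∈ Icc 1 R, ((k : ℝ) ^ 2)⁻¹) * (1 + (p : ℝ)⁻¹)) := by
    have h2 : (1 + (p : ℝ)⁻¹) = ∑ e ∈ range 2, ((p : ℝ) ^ e)⁻¹ := by simp [sum_range_succ]
    rw [h2, sum_mul_sum, ← sum_product', sum_mul_sum, ← sum_product']
    refine sum_congr rfl fun t _ ↦ ?_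
    push_cast
    rw [mul_inv, mul_inv]
  have hLpos : 0 ≤ ∑ l ∈ L, (l : ℝ)⁻¹ := sum_nonneg fun _ _ ↦ by positivity
  calc Real.log (R + 1) ≤ harmonic R := by exact_mod_cast log_add_one_le_harmonic R
    _ = ∑ n ∈ Icc 1 R, (n : ℝ)⁻¹ := by rw [harmonic_eq_sum_Icc]; push_cast; rfl
    _ ≤ ∑ n ∈ (L ×ˢ (Icc 1 R ×ˢ range 2)).image
          (fun t ↦ (t.1 * (t.2.1 ^ 2 * p ^ t.2.2) : ℕ)),
          (n : ℝ)⁻¹ := sum_le_sum_of_subset_of_nonneg hsub fun _ _ _ ↦ by positivity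
    _ ≤ ∑ t ∈ L ×ˢ (Icc 1 R ×ˢ range 2), (((t.1 * (t.2.1 ^ 2 * p ^ t.2.2) : ℕ)) : ℝ)⁻¹ :=
        sum_image_le_of_nonneg fun _ _ ↦ by positivity
    _ = (∑ l ∈ L, (l : ℝ)⁻¹) * ((∑ k ∈ Icc 1 R, ((k : ℝ) ^ 2)⁻¹) * (1 + (p : ℝ)⁻¹)) := hprod
    _ ≤ (∑ l ∈ L, (l : ℝ)⁻¹) * (2 * (1 + 2⁻¹)) := by
        gcongr
        exact sum_Icc_inv_sq_le_two R
    _ = 3 * ∑ l ∈ L, (l : ℝ)⁻¹ := by ring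

theorem abs_card_Ioc_filter_modEq_sub_le {r : ℕ} (hr : 0 < r) (N v : ℕ) :
    |(#{n ∈ Ioc 0 N | n ≡ v [MOD r]} : ℝ) - (N : ℝ) / r| ≤ 1 := by
  have h := Nat.Ioc_filter_modEq_card 0 N hr v
  have hr' : (0 : ℚ) < r := by exact_mod_cast hr
  have hle : ⌊(((0 : ℕ) : ℚ) - v) / (r : ℚ)⌋ ≤ ⌊((N : ℚ) - v) / (r : ℚ)⌋ := by
    gcongr
    simp
  rw [max_eq_left (by linarith)] at h
  have hq : |(#{n ∈ Ioc 0 N | n ≡ v [MOD r]} : ℚ) - (N : ℚ) / r| ≤ 1 := by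
    have h' : (#{n ∈ Ioc 0 N | n ≡ v [MOD r]} : ℚ) =
        (⌊((N : ℚ) - v) / (r : ℚ)⌋ : ℚ) - (⌊(((0 : ℕ) : ℚ) - v) / (r : ℚ)⌋ : ℚ) := by
      exact_mod_cast h
    rw [h']
    have e : (N : ℚ) / r = ((N : ℚ) - v) / (r : ℚ) - (((0 : ℕ) : ℚ) - v) / (r : ℚ) := by
      push_cast; ring
    rw [e, abs_le]
    have := Int.floor_le (((N : ℚ) - v) / (r : ℚ))
    have := Int.lt_floor_add_one (((N : ℚ) - v) / (r : ℚ))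
    have := Int.floor_le ((((0 : ℕ) : ℚ) - v) / (r : ℚ))
    have := Int.lt_floor_add_one ((((0 : ℕ) : ℚ) - v) / (r : ℚ))
    constructor <;> linarith
  rw [← Rat.cast_le (K := ℝ)] at hq
  push_cast at hq
  exact hq

/-- The sieve problem of removing the multiples of the primes `q ≤ R`, `q ≠ p`, from the residue
class of `a` modulo `p`. -/
noncomputable def residueClassSieve (p R a N : ℕ) : BoundingSieve where
  support := {n ∈ Ioc 0 N | n ≡ a [MOD p]}
  prodPrimes := primorialExcept p R
  prodPrimes_squarefree := squarefree_primorialExcept p R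
  weights _ := 1
  weights_nonneg _ := zero_le_one
  totalMass := N / p
  nu := ⟨fun n ↦ (n : ℝ)⁻¹, by simp⟩
  nu_mult := ⟨by simp, fun {m n} _ ↦ by simp [mul_comm]⟩
  nu_pos_of_prime q hq _ := by simpa using hq.pos
  nu_lt_one_of_prime q hq _ := by
    simpa using inv_lt_one_of_one_lt₀ (by exact_mod_cast hq.one_lt : (1 : ℝ) < q)

theorem abs_rem_residueClassSieve_le {p : ℕ} (hp : p.Prime) (R a N : ℕ) {d : ℕ}
    (hd : d ∣ primorialExcept p R) : |(residueClassSieve p R a N).rem d| ≤ 1 := by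
  have hcop : p.Coprime d := (coprime_primorialExcept hp R).coprime_dvd_right hd
  have hd0 : 0 < d := Nat.pos_of_dvd_of_pos hd
    (Nat.pos_of_ne_zero (squarefree_primorialExcept p R).ne_zero)
  obtain ⟨c, hc1, hc2⟩ := Nat.chineseRemainder hcop a 0
  have hset : {n ∈ {n ∈ Ioc 0 N | n ≡ a [MOD p]} | d ∣ n} =
      {n ∈ Ioc 0 N | n ≡ c [MOD p * d]} := by
    rw [filter_filter]
    refine filter_congr fun n _ ↦ ?_
    rw [← Nat.modEq_and_modEq_iff_modEq_mul hcop]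
    refine and_congr ⟨fun h ↦ h.trans hc1.symm, fun h ↦ h.trans hc1⟩ ?_
    rw [← Nat.modEq_zero_iff_dvd]
    exact ⟨fun h ↦ h.trans hc2.symm, fun h ↦ h.trans hc2⟩
  have := abs_card_Ioc_filter_modEq_sub_le (Nat.mul_pos hp.pos hd0) N c
  rw [← hset] at this
  convert this using 2
  simp only [BoundingSieve.rem, BoundingSieve.multSum, residueClassSieve]
  rw [← sum_filter, sum_const, nsmul_eq_mul, mul_one]
  simp only [ArithmeticFunction.coe_mk]
  push_cast
  field_simp

/-- A Brun–Titchmarsh type bound for the integers in a residue class free of small primes. -/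
theorem card_residueClass_sifted_le {p : ℕ} (hp : p.Prime) {R : ℕ} (hR : 1 ≤ R) (a N : ℕ)
    {A : Finset ℕ} (hA : A ⊆ {n ∈ Ioc 0 N | n ≡ a [MOD p]})
    (hA' : ∀ n ∈ A, ∀ q, q.Prime → q ≤ R → ¬ q ∣ n) :
    (#A : ℝ) ≤ 3 * N / (p * Real.log (R + 1)) + (R : ℝ) ^ 4 := by
  set s := residueClassSieve p R a N with hs
  have hR' : (1 : ℝ) ≤ R := by exact_mod_cast hR
  have hlog : 0 < Real.log (R + 1) := Real.log_pos (by linarith)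
  have hp0 : (0 : ℝ) < p := by exact_mod_cast hp.pos
  have hmain := s.siftedSum_le_div_selbergSum_add hR
    (fun d _ ↦ le_of_eq (by simp [hs, residueClassSieve]))
    (fun d hd ↦ abs_rem_residueClassSieve_le hp R a N hd)
  have hS : Real.log (R + 1) / 3 ≤ s.selbergSum R := by
    have h1 := log_succ_le_three_mul_sum_inv hp R
    have h2 : ∑ l ∈ (primorialExcept p R).divisors, (if l ≤ R then (l : ℝ)⁻¹ else 0) ≤
        s.selbergSum R := by
      refine sum_le_sum fun l hl ↦ ?_
      split_ifs with h
      · rw [BoundingSieve.selbergTerms_apply]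
        have hnu : s.nu l = (l : ℝ)⁻¹ := rfl
        rw [hnu]
        refine le_mul_of_one_le_right (by positivity) ?_
        refine Finset.one_le_prod fun q hq ↦ ?_
        have hq' := Nat.prime_of_mem_primeFactors hq
        have hnu' : s.nu q = (q : ℝ)⁻¹ := rfl
        rw [hnu']
        have h3 : (q : ℝ)⁻¹ < 1 := inv_lt_one_of_one_lt₀ (by exact_mod_cast hq'.one_lt)
        have h4 : (0 : ℝ) ≤ (q : ℝ)⁻¹ := by positivity
        exact (one_le_inv₀ (by linarith)).2 (by linarith)
      · exact le_rfl
    linarith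
  have hcard : (#A : ℝ) ≤ s.siftedSum := by
    have : s.siftedSum = #{n ∈ {n ∈ Ioc 0 N | n ≡ a [MOD p]} | (primorialExcept p R).Coprime n} := by
      rw [BoundingSieve.siftedSum, ← sum_filter]
      simp [hs, residueClassSieve]
    rw [this]
    exact_mod_cast card_le_card fun n hn ↦
      mem_filter.2 ⟨hA hn, coprime_primorialExcept_of_forall (hA' n hn)⟩
  refine hcard.trans (hmain.trans ?_)
  gcongr ?_ + _
  have : s.totalMass = N / p := rfl
  rw [this]
  calc (N : ℝ) / p / s.selbergSum R ≤ (N : ℝ) / p / (Real.log (R + 1) / 3) := by gcongr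
    _ = 3 * N / (p * Real.log (R + 1)) := by field_simp

end ResidueClass

section SumOfProperDivisors

open Finset

theorem sOf_mul_prime {m P : ℕ} (hP : P.Prime) (hPm : ¬ P ∣ m) :
    sOf (m * P) = sOf m * P + sOf m + m := by
  have h1 := Nat.sum_divisors_eq_sum_properDivisors_add_self (n := m * P)
  have h2 := Nat.sum_divisors_eq_sum_properDivisors_add_self (n := m)
  have hcop : m.Coprime P := ((Nat.Prime.coprime_iff_not_dvd hP).2 hPm).symm
  have h3 := hcop.sum_divisors_mul
  have h4 : ∑ d ∈ P.divisors, d = P + 1 := by rw [hP.sum_divisors, add_comm]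
  rw [h4, h2, h1] at h3
  simp only [sOf]
  nlinarith

/-- The primes `P` such that `p ∣ s(m * P)` lie in a single residue class modulo `p`, unless
`p ∣ m`. -/
theorem card_primes_dvd_sOf_le {p : ℕ} (hp : p.Prime) {R : ℕ} (hR : 1 ≤ R) (m N : ℕ)
    {A : Finset ℕ} (hA : ∀ P ∈ A, P.Prime ∧ P ≤ N ∧ R < P ∧ p ∣ sOf m * P + sOf m + m) :
    (#A : ℝ) ≤ (1 + if p ∣ m then (p : ℝ) else 0) *
      (3 * N / (p * Real.log (R + 1)) + (R : ℝ) ^ 4) := by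
  set B : ℝ := 3 * N / (p * Real.log (R + 1)) + (R : ℝ) ^ 4 with hB
  have hB0 : 0 ≤ B := by
    have : 0 ≤ Real.log (R + 1) := Real.log_nonneg (by simp)
    positivity
  have hclass : ∀ a, ∀ A' ⊆ A, (∀ P ∈ A', P ≡ a [MOD p]) → (#A' : ℝ) ≤ B := by
    intro a A' hA' hmod
    refine card_residueClass_sifted_le hp hR a N (fun P hP ↦ ?_) fun P hP q hq hqR hqP ↦ ?_
    · have := hA P (hA' hP)
      exact mem_filter.2 ⟨mem_Ioc.2 ⟨this.1.pos, this.2.1⟩, hmod P hP⟩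
    · have := hA P (hA' hP)
      have := (Nat.prime_dvd_prime_iff_eq hq this.1).1 hqP
      omega
  by_cases hpm : p ∣ m
  · rw [if_pos hpm]
    have hfib : (#A : ℝ) ≤ p * B := by
      have hmaps : ∀ P ∈ A, P % p ∈ range p := fun P _ ↦ mem_range.2 (Nat.mod_lt _ hp.pos)
      rw [card_eq_sum_card_fiberwise hmaps]
      push_cast
      calc ∑ a ∈ range p, (#{P ∈ A | P % p = a} : ℝ) ≤ ∑ _a ∈ range p, B := by
            refine sum_le_sum fun a ha ↦ hclass a _ (filter_subset _ _) fun P hP ↦ ?_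
            have h1 := (mem_filter.1 hP).2
            rw [Nat.ModEq, h1, Nat.mod_eq_of_lt (mem_range.1 ha)]
        _ = p * B := by simp
    linarith
  · rw [if_neg hpm, add_zero, one_mul]
    rcases A.eq_empty_or_nonempty with rfl | ⟨P₀, hP₀⟩
    · simpa using hB0
    have h0 := (hA P₀ hP₀).2.2.2
    have hps : ¬ p ∣ sOf m := fun h ↦ hpm <| by
      rw [Nat.dvd_add_right (dvd_add (h.mul_right _) h)] at h0
      exact h0
    refine hclass P₀ A subset_rfl fun P hP ↦ ?_
    have h1 := (hA P hP).2.2.2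
    have hcop : Nat.gcd p (sOf m) = 1 := (Nat.Prime.coprime_iff_not_dvd hp).2 hps
    refine Nat.ModEq.cancel_left_of_coprime hcop ?_
    have h2 : sOf m * P + (sOf m + m) ≡ sOf m * P₀ + (sOf m + m) [MOD p] := by
      rw [← add_assoc, ← add_assoc]
      exact (Nat.modEq_zero_iff_dvd.2 h1).trans (Nat.modEq_zero_iff_dvd.2 h0).symm
    exact h2.add_right_cancel'

theorem sum_inv_le_one_add_log {x : ℝ} (hx : 1 ≤ x) :
    ∑ m ∈ Icc 1 ⌊x⌋₊, (m : ℝ)⁻¹ ≤ 1 + Real.log x := by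
  have h := harmonic_le_one_add_log ⌊x⌋₊
  rw [harmonic_eq_sum_Icc] at h
  push_cast at h
  have h1 : (0 : ℝ) < ⌊x⌋₊ := by exact_mod_cast Nat.floor_pos.2 hx
  have := Real.log_le_log h1 (Nat.floor_le (by linarith))
  linarith

theorem sum_dvd_div_le {p : ℕ} (hp : 0 < p) (M : ℕ) :
    ∑ m ∈ Icc 1 M, (if p ∣ m then (p : ℝ) else 0) / m ≤ ∑ m ∈ Icc 1 M, (m : ℝ)⁻¹ := by
  have hp' : (p : ℝ) ≠ 0 := by positivity
  have hinj : Set.InjOn (fun k ↦ p * k) (Icc 1 M) := fun a _ b _ h ↦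
    Nat.eq_of_mul_eq_mul_left hp h
  calc ∑ m ∈ Icc 1 M, (if p ∣ m then (p : ℝ) else 0) / m
      = ∑ m ∈ Icc 1 M with p ∣ m, (p : ℝ) / m := by
        rw [sum_filter]
        exact sum_congr rfl fun m _ ↦ by split_ifs <;> simp
    _ ≤ ∑ m ∈ (Icc 1 M).image (fun k ↦ p * k), (p : ℝ) / m := by
        refine sum_le_sum_of_subset_of_nonneg (fun m hm ↦ ?_) fun _ _ _ ↦ by positivity
        obtain ⟨h1, k, rfl⟩ := mem_filter.1 hm
        rw [mem_Icc] at h1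
        exact mem_image.2 ⟨k, mem_Icc.2 ⟨Nat.pos_of_mul_pos_left h1.1,
          (Nat.le_mul_of_pos_left k hp).trans h1.2⟩, rfl⟩
    _ = ∑ m ∈ Icc 1 M, (m : ℝ)⁻¹ := by
        rw [sum_image hinj]
        refine sum_congr rfl fun k _ ↦ ?_
        push_cast
        rw [div_mul_eq_div_div, div_self hp', one_div]

/-- The prime cofactors `P > T` of `m` with `m * P ≤ x` for which `p ∣ s(m * P)`. -/
noncomputable def largePrimeCofactors (x T : ℝ) (p m : ℕ) : Finset ℕ :=
  {P ∈ Icc 1 ⌊x / m⌋₊ | P.Prime ∧ T < P ∧ p ∣ sOf m * P + sOf m + m}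

theorem card_OmegaSet_filter_le (x : ℝ) (p : ℕ) :
    #((OmegaSet x).filter fun n ↦ p ∣ sOf n) ≤ ∑ m ∈ Icc 1 ⌊x⌋₊,
      #(largePrimeCofactors x
        (x ^ (1 / Real.log (Real.log (Real.log (Real.log x))))) p m) := by
  set T := x ^ (1 / Real.log (Real.log (Real.log (Real.log x)))) with hT
  have hsub : (OmegaSet x).filter (fun n ↦ p ∣ sOf n) ⊆
      (Icc 1 ⌊x⌋₊).biUnion fun m ↦ (largePrimeCofactors x T p m).image fun P ↦ m * P := by
    intro n hn
    simp only [OmegaSet, mem_filter, mem_Icc, ← hT] at hn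
    obtain ⟨⟨⟨hn2, hnx⟩, -, hTP, hsq⟩, hpn⟩ := hn
    have hmem : maxPrimeFac n ∈ n.primeFactors := by
      obtain ⟨q, hq, h⟩ := exists_mem_eq_sup _ (Nat.nonempty_primeFactors.2 hn2) id
      rw [maxPrimeFac, if_neg (by omega), h]
      exact hq
    generalize maxPrimeFac n = P at *
    obtain ⟨hP, ⟨m, rfl⟩, hn0⟩ := Nat.mem_primeFactors.1 hmem
    have hm0 : 0 < m := Nat.pos_of_ne_zero (right_ne_zero_of_mul hn0)
    have hPm : ¬ P ∣ m := fun h ↦ hsq (by rw [sq]; exact mul_dvd_mul_left P h)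
    rw [mul_comm, sOf_mul_prime hP hPm] at hpn
    have hx : ((P * m : ℕ) : ℝ) ≤ x := (Nat.le_floor_iff' hn0).1 hnx
    have hm0' : (0 : ℝ) < m := by exact_mod_cast hm0
    refine mem_biUnion.2 ⟨m, mem_Icc.2 ⟨hm0, (Nat.le_mul_of_pos_left m hP.pos).trans hnx⟩,
      mem_image.2 ⟨P, ?_, mul_comm _ _⟩⟩
    refine mem_filter.2 ⟨mem_Icc.2 ⟨hP.one_le, ?_⟩, hP, hTP, hpn⟩
    refine Nat.le_floor ?_
    rw [le_div_iff₀ hm0']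
    exact_mod_cast hx
  exact (card_le_card hsub).trans (card_biUnion_le.trans (sum_le_sum fun _ _ ↦ card_image_le))

theorem card_largePrimeCofactors_le {x T b : ℝ} {p : ℕ} (hp : p.Prime) {R m : ℕ} (hR : 1 ≤ R)
    (hx : 0 ≤ x) (hT : 0 < T) (hRT : R ≤ T) (hm : 0 < m)
    (hb : 3 / (p * Real.log (R + 1)) + (R : ℝ) ^ 4 / T ≤ b) :
    (#(largePrimeCofactors x T p m) : ℝ) ≤ x * b * (1 + if p ∣ m then (p : ℝ) else 0) / m := by
  have hlog : 0 ≤ Real.log (R + 1) := Real.log_nonneg (by simp)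
  have hb0 : 0 ≤ b := le_trans (by positivity) hb
  have hm' : (0 : ℝ) < m := by exact_mod_cast hm
  have hfac : 0 ≤ 1 + if p ∣ m then (p : ℝ) else 0 := by split_ifs <;> positivity
  rcases (largePrimeCofactors x T p m).eq_empty_or_nonempty with h | ⟨P, hP⟩
  · rw [h]
    simp only [card_empty, Nat.cast_zero]
    positivity
  have hmem : ∀ P ∈ largePrimeCofactors x T p m,
      P.Prime ∧ P ≤ ⌊x / m⌋₊ ∧ R < P ∧ p ∣ sOf m * P + sOf m + m := by
    intro P hP
    obtain ⟨h1, h2, h3, h4⟩ := mem_filter.1 hP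
    exact ⟨h2, (mem_Icc.1 h1).2, by exact_mod_cast hRT.trans_lt h3, h4⟩
  have hxm : T ≤ x / m := by
    obtain ⟨h1, h2, h3, h4⟩ := mem_filter.1 hP
    exact h3.le.trans ((Nat.le_floor_iff (by positivity)).1 (mem_Icc.1 h1).2)
  have hN : (⌊x / m⌋₊ : ℝ) ≤ x / m := Nat.floor_le (by positivity)
  calc (#(largePrimeCofactors x T p m) : ℝ)
      ≤ (1 + if p ∣ m then (p : ℝ) else 0) *
        (3 * ⌊x / m⌋₊ / (p * Real.log (R + 1)) + (R : ℝ) ^ 4) :=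
        card_primes_dvd_sOf_le hp hR m _ hmem
    _ ≤ (1 + if p ∣ m then (p : ℝ) else 0) * (x / m * b) := by
        refine mul_le_mul_of_nonneg_left ?_ hfac
        calc 3 * (⌊x / m⌋₊ : ℝ) / (p * Real.log (R + 1)) + (R : ℝ) ^ 4
            ≤ 3 * (x / m) / (p * Real.log (R + 1)) + (x / m) * ((R : ℝ) ^ 4 / T) := by
              gcongr
              rw [mul_div_assoc', le_div_iff₀ hT, mul_comm]
              gcongr
          _ = x / m * (3 / (p * Real.log (R + 1)) + (R : ℝ) ^ 4 / T) := by ring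
          _ ≤ x / m * b := by gcongr
    _ = x * b * (1 + if p ∣ m then (p : ℝ) else 0) / m := by ring

theorem eventually_six_mul_log_mul_log_log_log_le :
    ∀ᶠ u : ℝ in atTop, 6 * Real.log (Real.log (Real.log u)) * Real.log u ≤ u := by
  have h := (Real.isLittleO_pow_log_id_atTop (n := 2)).bound (by norm_num : (0 : ℝ) < 1 / 6)
  filter_upwards [h, eventually_ge_atTop 0,
    Real.tendsto_log_atTop.eventually_gt_atTop 1] with u hu hu0 hu1
  have h1 : 0 < Real.log (Real.log u) := Real.log_pos hu1
  have h2 := Real.log_le_self h1.le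
  have h3 := Real.log_le_self (by linarith : 0 ≤ Real.log u)
  simp only [id, Real.norm_eq_abs, abs_of_nonneg hu0, abs_of_nonneg (sq_nonneg (Real.log u))] at hu
  nlinarith

/-- The numerical input to the sieve: with `T = exp (u / L)` and `R = ⌊T ^ (1 / 8)⌋`. -/
theorem sieve_level_bound {u L : ℝ} {p : ℕ} (hp : 0 < p) (hu : 1 ≤ u) (hL : 1 ≤ L)
    (hLu : 6 * L * Real.log u ≤ u) (hpu : (p : ℝ) ≤ u ^ 2) :
    3 / (p * Real.log (⌊Real.exp (u / (8 * L))⌋₊ + 1)) +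
      (⌊Real.exp (u / (8 * L))⌋₊ : ℝ) ^ 4 / Real.exp (u / L) ≤ 25 * L / (p * u) := by
  have hp' : (0 : ℝ) < p := by exact_mod_cast hp
  have hu0 : 0 < u := by linarith
  have hL0 : 0 < L := by linarith
  have h1 : u / (8 * L) ≤ Real.log (⌊Real.exp (u / (8 * L))⌋₊ + 1) := by
    rw [Real.le_log_iff_exp_le (by positivity)]
    exact (Nat.lt_floor_add_one _).le
  have h2 : 3 / (p * Real.log (⌊Real.exp (u / (8 * L))⌋₊ + 1)) ≤ 24 * L / (p * u) := by
    calc _ ≤ 3 / (p * (u / (8 * L))) := by gcongr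
      _ = 24 * L / (p * u) := by field_simp; norm_num
  have h3 : (⌊Real.exp (u / (8 * L))⌋₊ : ℝ) ^ 4 / Real.exp (u / L) ≤ L / (p * u) := by
    calc (⌊Real.exp (u / (8 * L))⌋₊ : ℝ) ^ 4 / Real.exp (u / L)
        ≤ Real.exp (u / (8 * L)) ^ 4 / Real.exp (u / L) := by
          gcongr
          exact Nat.floor_le (Real.exp_pos _).le
      _ = Real.exp (-(u / (2 * L))) := by
          rw [← Real.exp_nat_mul, ← Real.exp_sub]
          congr 1
          field_simp
          norm_num
      _ ≤ Real.exp (-(3 * Real.log u)) := by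
          gcongr
          rw [le_div_iff₀ (by positivity)]
          linarith
      _ = 1 / (u ^ 2 * u) := by
          rw [Real.exp_neg, one_div, ← pow_succ, ← Real.exp_log (pow_pos hu0 _), Real.log_pow]
          norm_num
      _ ≤ L / (p * u) := by gcongr
  calc _ ≤ 24 * L / (p * u) + L / (p * u) := add_le_add h2 h3
    _ = 25 * L / (p * u) := by ring

end SumOfProperDivisors

/-- There is an absolute constant `C` such that for all sufficiently large `x` and every
prime `p ≤ (log x)²`, the number of `n ∈ Ω_x` with `p ∣ s(n)` is at most
`C · x · log₄ x / p`. -/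
theorem count_divisible_small_prime :
    ∃ C : ℝ, 0 < C ∧ ∀ᶠ x : ℝ in atTop, ∀ p : ℕ, p.Prime → (p : ℝ) ≤ (Real.log x) ^ 2 →
      (((OmegaSet x).filter (fun n => p ∣ sOf n)).card : ℝ)
        ≤ C * x * Real.log (Real.log (Real.log (Real.log x))) / p := by
  refine ⟨100, by norm_num, ?_⟩
  have hlog := Real.tendsto_log_atTop
  filter_upwards [eventually_ge_atTop 1, hlog.eventually_ge_atTop 1,
    (((hlog.comp hlog).comp hlog).comp hlog).eventually_ge_atTop 1,
    hlog.eventually eventually_six_mul_log_mul_log_log_log_le] with x hx hu hL hLu p hp hpu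
  simp only [Function.comp_apply] at hL
  have hcard := card_OmegaSet_filter_le x p
  set u := Real.log x with hu_def
  set L := Real.log (Real.log (Real.log u)) with hL_def
  have hx0 : 0 < x := by linarith
  have hu0 : 0 < u := by linarith
  have hp0 : (0 : ℝ) < p := by exact_mod_cast hp.pos
  have hT : x ^ (1 / L) = Real.exp (u / L) := by
    rw [Real.rpow_def_of_pos hx0, mul_one_div]
  rw [hT] at hcard
  have hR : 1 ≤ ⌊Real.exp (u / (8 * L))⌋₊ :=
    Nat.le_floor (by simpa using Real.one_le_exp (by positivity : 0 ≤ u / (8 * L)))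
  have hRT : (⌊Real.exp (u / (8 * L))⌋₊ : ℝ) ≤ Real.exp (u / L) := by
    refine (Nat.floor_le (Real.exp_pos _).le).trans ?_
    gcongr
    linarith
  have hb := sieve_level_bound hp.pos hu hL hLu hpu
  set b := 25 * L / (p * u) with hb_def
  have hsum := sum_inv_le_one_add_log hx
  have hsum' := (sum_dvd_div_le hp.pos ⌊x⌋₊).trans hsum
  calc (((OmegaSet x).filter (fun n => p ∣ sOf n)).card : ℝ)
      ≤ ∑ m ∈ Finset.Icc 1 ⌊x⌋₊, ((largePrimeCofactors x (Real.exp (u / L)) p m).card : ℝ) := by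
        exact_mod_cast hcard
    _ ≤ ∑ m ∈ Finset.Icc 1 ⌊x⌋₊, x * b * (1 + if p ∣ m then (p : ℝ) else 0) / m :=
        Finset.sum_le_sum fun m hm ↦ card_largePrimeCofactors_le hp hR hx0.le (Real.exp_pos _) hRT
          (Finset.mem_Icc.1 hm).1 hb
    _ = x * b * (∑ m ∈ Finset.Icc 1 ⌊x⌋₊, (m : ℝ)⁻¹ +
          ∑ m ∈ Finset.Icc 1 ⌊x⌋₊, (if p ∣ m then (p : ℝ) else 0) / m) := by
        rw [← Finset.sum_add_distrib, Finset.mul_sum]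
        exact Finset.sum_congr rfl fun m _ ↦ by ring
    _ ≤ x * b * (4 * u) := by
        gcongr
        linarith
    _ = 100 * x * L / p := by
        rw [hb_def]
        field_simp
        norm_num
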